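/- The Fréchet derivative at θ₀ of the objective J : θ ↦ Σ_{τ ∈ (S×A)^H} P_θ(τ) · R s_H(τ) a_H(τ) equals Σ_{τ ∈ (S×A)^H} (P_{θ₀}(τ) · R s_H(τ) a_H(τ)) • Σ_{i=1}^{I(τ)+1} Σ_{h = t_{i-1}(τ)+1}^{t_i(τ)} D_θ (log (π θ s_h(τ) a_h(τ)))|_{θ=θ₀}, where D_θ (log (π θ s a))|_{θ=θ₀} denotes the Fréchet derivative at θ₀ of θ ↦ Real.log (π θ s a). That is, the policy gradient of the full rollout decomposes into the sum, over the I(τ)+1 summarized sub-trajectories delimited by the indices t_0(τ) < t_1(τ) < ⋯ < t_{I(τ)+1}(τ), of the per-step log-derivative contributions within each sub-trajectory. -/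

import Mathlib

open scoped BigOperators

/-- The probability weight of a length-`H` trajectory `τ = ((s_1,a_1),…,(s_H,a_H))`
(represented 0-indexed as `τ : Fin H → S × A`):
`P_θ(τ) = μ s_1 · (Π_{h=1}^{H-1} π θ s_h a_h · P s_h a_h s_{h+1}) · π θ s_H a_H`. -/
noncomputable def trajWeight {S A E : Type*} (H : ℕ) (hH : 0 < H)
    (μ : S → ℝ) (P : S → A → S → ℝ) (π : E → S → A → ℝ)
    (θ : E) (τ : Fin H → S × A) : ℝ :=
  μ (τ ⟨0, hH⟩).1 *
    (∏ h ∈ Finset.univ.filter (fun h : Fin H => (h : ℕ) + 1 < H),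
      π θ (τ h).1 (τ h).2 * P (τ h).1 (τ h).2 (τ ⟨((h : ℕ) + 1) % H, Nat.mod_lt _ hH⟩).1) *
    π θ (τ ⟨H - 1, Nat.sub_lt hH one_pos⟩).1 (τ ⟨H - 1, Nat.sub_lt hH one_pos⟩).2

/-- The 0-indexed position in a length-`H` trajectory of the (1-based) step `h`;
for `1 ≤ h ≤ H` this is exactly `h - 1`. -/
def stepIdx (H : ℕ) (hH : 0 < H) (h : ℕ) : Fin H := ⟨min (h - 1) (H - 1), by omega⟩

/-- Logarithmic differentiation of a finite product of nonvanishing functions. -/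
theorem hasFDerivAt_finset_prod_log {ι E : Type*} [NormedAddCommGroup E] [NormedSpace ℝ E]
    (s : Finset ι) (f : ι → E → ℝ) (x : E)
    (hf : ∀ i ∈ s, DifferentiableAt ℝ (f i) x) (hne : ∀ i ∈ s, f i x ≠ 0) :
    HasFDerivAt (fun y => ∏ i ∈ s, f i y)
      ((∏ i ∈ s, f i x) • ∑ i ∈ s, fderiv ℝ (fun y => Real.log (f i y)) x) x := by
  classical
  induction s using Finset.induction_on with
  | empty => simpa using hasFDerivAt_const (1 : ℝ) x
  | insert a s ha ih =>
    have hfa := hf a (Finset.mem_insert_self a s)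
    have hnea := hne a (Finset.mem_insert_self a s)
    have hs := ih (fun i hi => hf i (Finset.mem_insert_of_mem hi))
      (fun i hi => hne i (Finset.mem_insert_of_mem hi))
    simp only [Finset.prod_insert ha, Finset.sum_insert ha]
    refine (hfa.hasFDerivAt.fun_mul hs).congr_fderiv ?_
    rw [fderiv.log hfa hnea, smul_add, smul_smul, smul_smul, add_comm]
    congr 2
    field_simp

/-- Consecutive half-open intervals delimited by monotone cut points concatenate. -/
theorem sum_Icc_sum_Ioc_eq_sum_Ioc {M : Type*} [AddCommMonoid M] (t : ℕ → ℕ) (f : ℕ → M) (n : ℕ)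
    (ht : ∀ i, 1 ≤ i → i ≤ n → t (i - 1) ≤ t i) :
    t 0 ≤ t n ∧ ∑ i ∈ Finset.Icc 1 n, ∑ h ∈ Finset.Ioc (t (i - 1)) (t i), f h =
      ∑ h ∈ Finset.Ioc (t 0) (t n), f h := by
  induction n with
  | zero => simp
  | succ n ih =>
    obtain ⟨hle, hsum⟩ := ih fun i h1 hi => ht i h1 (by omega)
    have hstep : t n ≤ t (n + 1) := ht (n + 1) (by omega) le_rfl
    refine ⟨hle.trans hstep, ?_⟩
    rw [Finset.sum_Icc_succ_top (by omega), hsum, Nat.add_sub_cancel,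
      Finset.sum_Ioc_consecutive f hle hstep]

theorem sum_Ioc_stepIdx {M : Type*} [AddCommMonoid M] (H : ℕ) (hH : 0 < H) (f : Fin H → M) :
    ∑ h ∈ Finset.Ioc 0 H, f (stepIdx H hH h) = ∑ k, f k := by
  refine Finset.sum_nbij' (fun h => stepIdx H hH h) (fun k => (k : ℕ) + 1) ?_ ?_ ?_ ?_ ?_
  · simp
  · intro k _
    simp only [Finset.mem_Ioc]
    omega
  · intro h hh
    simp only [Finset.mem_Ioc] at hh
    simp only [stepIdx]
    omega
  · intro k _
    ext
    simp only [stepIdx]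
    omega
  · simp

/-- The trajectory weight is a parameter-free factor times the product of the action
probabilities along the trajectory. -/
theorem exists_trajWeight_eq_mul_prod {S A E : Type*} (H : ℕ) (hH : 0 < H)
    (μ : S → ℝ) (P : S → A → S → ℝ) (π : E → S → A → ℝ) (τ : Fin H → S × A) :
    ∃ c : ℝ, ∀ θ, trajWeight H hH μ P π θ τ = c * ∏ h, π θ (τ h).1 (τ h).2 := by
  obtain ⟨n, rfl⟩ : ∃ n, H = n + 1 := ⟨H - 1, by omega⟩
  refine ⟨μ (τ ⟨0, hH⟩).1 * ∏ h ∈ Finset.univ.filter (fun h : Fin (n + 1) => (h : ℕ) + 1 < n + 1),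
    P (τ h).1 (τ h).2 (τ ⟨((h : ℕ) + 1) % (n + 1), Nat.mod_lt _ hH⟩).1, fun θ => ?_⟩
  have hprod : ∏ h, π θ (τ h).1 (τ h).2 =
      (∏ h ∈ Finset.univ.filter (fun h : Fin (n + 1) => (h : ℕ) + 1 < n + 1),
        π θ (τ h).1 (τ h).2) * π θ (τ (Fin.last n)).1 (τ (Fin.last n)).2 := by
    rw [Finset.prod_filter, Fin.prod_univ_castSucc, Fin.prod_univ_castSucc]
    simp
  have hlast : (⟨n + 1 - 1, Nat.sub_lt hH one_pos⟩ : Fin (n + 1)) = Fin.last n := rfl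
  rw [trajWeight, hprod, Finset.prod_mul_distrib, hlast]
  ring

/-- The log-derivative identity for trajectory weights. -/
theorem hasFDerivAt_trajWeight {S A E : Type*} [NormedAddCommGroup E] [NormedSpace ℝ E]
    (H : ℕ) (hH : 0 < H) (μ : S → ℝ) (P : S → A → S → ℝ) (θ₀ : E) (π : E → S → A → ℝ)
    (hdiff : ∀ s a, DifferentiableAt ℝ (fun θ => π θ s a) θ₀)
    (hne : ∀ s a, π θ₀ s a ≠ 0) (τ : Fin H → S × A) :
    HasFDerivAt (fun θ => trajWeight H hH μ P π θ τ)
      (trajWeight H hH μ P π θ₀ τ •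
        ∑ h, fderiv ℝ (fun θ => Real.log (π θ (τ h).1 (τ h).2)) θ₀) θ₀ := by
  obtain ⟨c, hc⟩ := exists_trajWeight_eq_mul_prod H hH μ P π τ
  simp only [hc, mul_smul]
  exact (hasFDerivAt_finset_prod_log Finset.univ (fun h θ => π θ (τ h).1 (τ h).2) θ₀
    (fun h _ => hdiff _ _) (fun h _ => hne _ _)).const_mul c

/-- (Policy gradient decomposed along summarized sub-trajectories.) The
Fréchet derivative at `θ₀` of the objective `J : θ ↦ Σ_τ P_θ(τ) · R s_H(τ) a_H(τ)` equals
`Σ_τ (P_{θ₀}(τ) · R s_H(τ) a_H(τ)) •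
  Σ_{i=1}^{I(τ)+1} Σ_{h=t_{i-1}(τ)+1}^{t_i(τ)} D_θ (log (π θ s_h(τ) a_h(τ)))|_{θ=θ₀}`,
where for each trajectory `τ` the summarization cut indices satisfy `t_0(τ) = 0`,
`t_{I(τ)+1}(τ) = H`, and `t_{i-1}(τ) ≤ t_i(τ)`. -/
theorem policy_gradient_subtrajectory_decomposition {S A : Type*} [Fintype S] [Fintype A]
    {E : Type*} [NormedAddCommGroup E] [NormedSpace ℝ E]
    (H : ℕ) (hH : 0 < H) (μ : S → ℝ) (P : S → A → S → ℝ) (R : S → A → ℝ)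
    (θ₀ : E) (π : E → S → A → ℝ)
    (hdiff : ∀ s a, DifferentiableAt ℝ (fun θ => π θ s a) θ₀)
    (hpos : ∀ s a, 0 < π θ₀ s a)
    (I : (Fin H → S × A) → ℕ) (t : (Fin H → S × A) → ℕ → ℕ)
    (ht0 : ∀ τ, t τ 0 = 0) (htH : ∀ τ, t τ (I τ + 1) = H)
    (htmono : ∀ τ, ∀ i, 1 ≤ i → i ≤ I τ + 1 → t τ (i - 1) ≤ t τ i) :
    fderiv ℝ
      (fun θ => ∑ τ : Fin H → S × A, trajWeight H hH μ P π θ τ *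
        R (τ ⟨H - 1, Nat.sub_lt hH one_pos⟩).1 (τ ⟨H - 1, Nat.sub_lt hH one_pos⟩).2) θ₀ =
      ∑ τ : Fin H → S × A,
        (trajWeight H hH μ P π θ₀ τ *
            R (τ ⟨H - 1, Nat.sub_lt hH one_pos⟩).1 (τ ⟨H - 1, Nat.sub_lt hH one_pos⟩).2) •
          ∑ i ∈ Finset.Icc 1 (I τ + 1), ∑ h ∈ Finset.Ioc (t τ (i - 1)) (t τ i),
            fderiv ℝ
              (fun θ => Real.log (π θ (τ (stepIdx H hH h)).1 (τ (stepIdx H hH h)).2)) θ₀ := by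
  have hderiv := HasFDerivAt.fun_sum (u := Finset.univ) fun (τ : Fin H → S × A) _ =>
    (hasFDerivAt_trajWeight H hH μ P θ₀ π hdiff (fun s a => (hpos s a).ne') τ).mul_const
      (R (τ ⟨H - 1, Nat.sub_lt hH one_pos⟩).1 (τ ⟨H - 1, Nat.sub_lt hH one_pos⟩).2)
  rw [hderiv.fderiv]
  refine Finset.sum_congr rfl fun τ _ => ?_
  rw [(sum_Icc_sum_Ioc_eq_sum_Ioc (t τ) _ (I τ + 1) (htmono τ)).2, ht0, htH,
    sum_Ioc_stepIdx H hH fun k => fderiv ℝ (fun θ => Real.log (π θ (τ k).1 (τ k).2)) θ₀,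
    smul_smul, mul_comm]
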